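/- Let a : ℕ → ℂ be a sequence with ∑_{n=0}^∞ η_n |a_n|² < ∞. Then for every z ∈ ℂ the series f(z) = ∑_{n=0}^∞ a_n zⁿ converges absolutely and |f(z)|² ≤ E(|z|²) · ∑_{n=0}^∞ η_n |a_n|², where E(r) = ∑_{n=0}^∞ rⁿ/η_n. In particular, |f(z)| ≤ √(8) e^{|z|²} (∑_{n=0}^∞ η_n |a_n|²)^{1/2}. -/

import Mathlib

open MeasureTheory

/-- The moment sequence of the Hörmander-Fock space. -/
noncomputable def eta (n : ℕ) : ℝ :=
  ∫ t in Set.Ioi (0 : ℝ), t ^ n / (1 + t) ^ 2 * Real.exp (-t)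

/-- The special entire function `E` restricted to real arguments. -/
noncomputable def Efun (r : ℝ) : ℝ := ∑' n : ℕ, r ^ n / eta n

lemma integrableOn_pow_mul_exp_neg_mul (n : ℕ) {b : ℝ} (hb : 0 < b) :
    IntegrableOn (fun t : ℝ => t ^ n * Real.exp (-(b * t))) (Set.Ioi 0) := by
  have h := integrableOn_rpow_mul_exp_neg_mul_rpow (p := 1) (s := n) (b := b)
    (by have : (0 : ℝ) ≤ n := n.cast_nonneg
        linarith) one_pos hb
  simpa using h

lemma integral_pow_mul_exp_neg_two_mul (n : ℕ) :
    ∫ t in Set.Ioi (0 : ℝ), t ^ n * Real.exp (-(2 * t)) = n.factorial / 2 ^ (n + 1) := by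
  have h := Real.integral_rpow_mul_exp_neg_mul_Ioi (a := n + 1) (r := 2) (by positivity) two_pos
  rw [Real.Gamma_nat_eq_factorial, add_sub_cancel_right] at h
  simp only [Real.rpow_natCast] at h
  rw [h, ← Nat.cast_succ, Real.rpow_natCast, one_div, inv_pow, Nat.succ_eq_add_one]
  ring

lemma one_add_sq_le_four_mul_exp {t : ℝ} (ht : 0 ≤ t) : (1 + t) ^ 2 ≤ 4 * Real.exp t := by
  have h := Real.add_one_le_exp (t / 2)
  have h2 : Real.exp t = Real.exp (t / 2) ^ 2 := by
    rw [← Real.exp_nat_mul]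
    congr 1
    push_cast
    ring
  rw [h2]
  nlinarith

lemma factorial_div_le_eta (n : ℕ) : (n.factorial : ℝ) / (8 * 2 ^ n) ≤ eta n := by
  have hint : IntegrableOn (fun t : ℝ => t ^ n / (1 + t) ^ 2 * Real.exp (-t)) (Set.Ioi 0) := by
    refine (integrableOn_pow_mul_exp_neg_mul n one_pos).mono' ?_ ?_
    · exact Measurable.aestronglyMeasurable (by fun_prop)
    · refine (ae_restrict_iff' measurableSet_Ioi).2 (.of_forall fun t ht => ?_)
      have ht : (0 : ℝ) < t := ht
      rw [Real.norm_of_nonneg (by positivity), one_mul]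
      gcongr
      exact div_le_self (by positivity) (one_le_pow₀ (by linarith))
  have key : ∫ t in Set.Ioi (0 : ℝ), t ^ n * Real.exp (-(2 * t)) / 4 ≤ eta n := by
    refine setIntegral_mono_on ((integrableOn_pow_mul_exp_neg_mul n two_pos).div_const 4) hint
      measurableSet_Ioi fun t ht => ?_
    have ht : (0 : ℝ) < t := ht
    have hexp : Real.exp (-(2 * t)) = Real.exp (-t) * (Real.exp t)⁻¹ := by
      rw [← Real.exp_neg, ← Real.exp_add]
      ring_nf
    calc t ^ n * Real.exp (-(2 * t)) / 4
        = t ^ n / (4 * Real.exp t) * Real.exp (-t) := by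
          rw [hexp]
          field_simp
      _ ≤ _ := by
          gcongr
          exact one_add_sq_le_four_mul_exp ht.le
  rw [integral_div, integral_pow_mul_exp_neg_two_mul] at key
  convert key using 1
  field_simp
  ring

lemma eta_pos (n : ℕ) : 0 < eta n :=
  lt_of_lt_of_le (by positivity) (factorial_div_le_eta n)

lemma pow_div_eta_le {r : ℝ} (hr : 0 ≤ r) (n : ℕ) :
    r ^ n / eta n ≤ 8 * ((2 * r) ^ n / n.factorial) := by
  calc r ^ n / eta n ≤ r ^ n / (n.factorial / (8 * 2 ^ n)) := by
        gcongr
        exact factorial_div_le_eta n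
    _ = _ := by
        rw [mul_pow]
        field_simp

lemma summable_pow_div_eta {r : ℝ} (hr : 0 ≤ r) : Summable fun n : ℕ => r ^ n / eta n :=
  .of_nonneg_of_le (fun n => div_nonneg (by positivity) (eta_pos n).le) (pow_div_eta_le hr)
    ((Real.summable_pow_div_factorial (2 * r)).mul_left 8)

lemma Efun_le {r : ℝ} (hr : 0 ≤ r) : Efun r ≤ 8 * Real.exp (2 * r) := by
  rw [Real.exp_eq_exp_ℝ, NormedSpace.exp_eq_tsum_div, ← tsum_mul_left]
  exact (summable_pow_div_eta hr).tsum_le_tsum (pow_div_eta_le hr)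
    ((Real.summable_pow_div_factorial (2 * r)).mul_left 8)

theorem stmt_11 (a : ℕ → ℂ) (ha : Summable fun n : ℕ => eta n * ‖a n‖ ^ 2) (z : ℂ) :
    Summable (fun n : ℕ => ‖a n * z ^ n‖) ∧
      ‖∑' n : ℕ, a n * z ^ n‖ ^ 2 ≤ Efun (‖z‖ ^ 2) * ∑' n : ℕ, eta n * ‖a n‖ ^ 2 ∧
      ‖∑' n : ℕ, a n * z ^ n‖ ≤
        Real.sqrt 8 * Real.exp (‖z‖ ^ 2) * Real.sqrt (∑' n : ℕ, eta n * ‖a n‖ ^ 2) := by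
  have hz : 0 ≤ ‖z‖ ^ 2 := by positivity
  have hf (n : ℕ) : (Real.sqrt ((‖z‖ ^ 2) ^ n / eta n)) ^ (2 : ℝ) = (‖z‖ ^ 2) ^ n / eta n := by
    rw [Real.rpow_two, Real.sq_sqrt (div_nonneg (by positivity) (eta_pos n).le)]
  have hg (n : ℕ) : (Real.sqrt (eta n * ‖a n‖ ^ 2)) ^ (2 : ℝ) = eta n * ‖a n‖ ^ 2 := by
    rw [Real.rpow_two, Real.sq_sqrt (mul_nonneg (eta_pos n).le (by positivity))]
  have hfg (n : ℕ) : Real.sqrt ((‖z‖ ^ 2) ^ n / eta n) * Real.sqrt (eta n * ‖a n‖ ^ 2)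
      = ‖a n * z ^ n‖ := by
    have := eta_pos n
    rw [← Real.sqrt_mul (by positivity), Real.sqrt_eq_iff_mul_self_eq (by positivity)
      (by positivity), norm_mul, norm_pow]
    field_simp
    ring
  obtain ⟨hs, hle⟩ := Real.summable_and_inner_le_Lp_mul_Lq_tsum_of_nonneg
    (f := fun n => Real.sqrt ((‖z‖ ^ 2) ^ n / eta n))
    (g := fun n => Real.sqrt (eta n * ‖a n‖ ^ 2)) Real.HolderConjugate.two_two
    (fun n => Real.sqrt_nonneg _) (fun n => Real.sqrt_nonneg _)
    (by simpa only [hf] using summable_pow_div_eta hz) (by simpa only [hg] using ha)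
  simp only [hf, hg, hfg, ← Real.sqrt_eq_rpow] at hs hle
  have hS : 0 ≤ ∑' n : ℕ, eta n * ‖a n‖ ^ 2 :=
    tsum_nonneg fun n => mul_nonneg (eta_pos n).le (by positivity)
  have hE : 0 ≤ Efun (‖z‖ ^ 2) :=
    tsum_nonneg fun n => div_nonneg (by positivity) (eta_pos n).le
  have hmain : ‖∑' n : ℕ, a n * z ^ n‖ ≤
      Real.sqrt (Efun (‖z‖ ^ 2)) * Real.sqrt (∑' n : ℕ, eta n * ‖a n‖ ^ 2) :=
    (norm_tsum_le_tsum_norm hs).trans hle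
  refine ⟨hs, ?_, hmain.trans ?_⟩
  · calc _ ≤ _ := pow_le_pow_left₀ (norm_nonneg _) hmain 2
      _ = _ := by rw [mul_pow, Real.sq_sqrt hE, Real.sq_sqrt hS]
  · gcongr
    calc Real.sqrt (Efun (‖z‖ ^ 2)) ≤ Real.sqrt (8 * Real.exp (2 * ‖z‖ ^ 2)) :=
          Real.sqrt_le_sqrt (Efun_le hz)
      _ = _ := by
          rw [Real.sqrt_mul (by norm_num), two_mul, Real.exp_add,
            Real.sqrt_mul_self (Real.exp_pos _).le]
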